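/- arXiv:1907.01769 — 2 statements merged into one kernel-verified Lean document; each statement's English description precedes it below -/
import Mathlib

section
/- The solution set X = argmin_{x ∈ ℝ^n} L(x) is nonempty, and for every x ∈ X, setting r = ‖D*x‖₁ and A = x + Ker Φ, one has X = A ∩ B_r and A ∩ B_r ⊆ ∂B_r. In particular X is a convex polyhedron of the form A ∩ B_r with A an affine subspace satisfying ∅ ≠ A ∩ B_r ⊆ ∂B_r and dir(A) = Ker Φ. -/
open Matrix Set

noncomputable section

/-- `Vec n` is `ℝ^n`. -/
abbrev Vec (n : ℕ) := Fin n → ℝ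

/-- The ℓ¹-norm on `ℝ^p`. -/
def l1 {p : ℕ} (θ : Vec p) : ℝ := ∑ i, |θ i|

/-- The componentwise sign vector. -/
def sgn {p : ℕ} (θ : Vec p) : Vec p := fun i => Real.sign (θ i)

/-- `s` is a sign vector, i.e. `s ∈ {-1,0,1}^p`. -/
def IsSignVec {p : ℕ} (s : Vec p) : Prop := ∀ i, s i = -1 ∨ s i = 0 ∨ s i = 1

/-- The order `s ≼ s'` on sign vectors: `sᵢ ≠ 0 → s'ᵢ = sᵢ`. -/
def sleq {p : ℕ} (s s' : Vec p) : Prop := ∀ i, s i ≠ 0 → s' i = s i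

/-- The cosupport `{i : uᵢ = 0}`. -/
def cosupp {p : ℕ} (u : Vec p) : Set (Fin p) := {i | u i = 0}

/-- The analysis operator `D* x = Dᵀ x`. -/
def Dstar {n p : ℕ} (D : Matrix (Fin n) (Fin p) ℝ) (x : Vec n) : Vec p := Dᵀ *ᵥ x

/-- The ball `B_r = {x : ‖D*x‖₁ ≤ r}`. -/
def Ball {n p : ℕ} (D : Matrix (Fin n) (Fin p) ℝ) (r : ℝ) : Set (Vec n) :=
  {x | l1 (Dstar D x) ≤ r}

/-- The sphere `∂B_r = {x : ‖D*x‖₁ = r}`. -/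
def Sph {n p : ℕ} (D : Matrix (Fin n) (Fin p) ℝ) (r : ℝ) : Set (Vec n) :=
  {x | l1 (Dstar D x) = r}

/-- `Ker D*_J = {x : (D*x)ᵢ = 0 for all i ∈ J}`. -/
def kerDJ {n p : ℕ} (D : Matrix (Fin n) (Fin p) ℝ) (J : Set (Fin p)) : Set (Vec n) :=
  {x | ∀ i ∈ J, Dstar D x i = 0}

/-- The relative interior of a set. -/
def ri {n : ℕ} (C : Set (Vec n)) : Set (Vec n) := intrinsicInterior ℝ C

/-- The direction of (the affine hull of) a set, as a set of vectors. -/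
def dir {n : ℕ} (C : Set (Vec n)) : Set (Vec n) := ((affineSpan ℝ C).direction : Set (Vec n))

/-- `F` is an exposed face of `X`: the intersection of `X` with a supporting hyperplane. -/
def IsExposedFace {n : ℕ} (X F : Set (Vec n)) : Prop :=
  ∃ (α : Vec n) (β : ℝ), α ≠ 0 ∧ (∀ x ∈ X, α ⬝ᵥ x ≤ β) ∧ F = X ∩ {x | α ⬝ᵥ x = β}

/-- `G` is a face of `X`: a convex extreme subset of `X`. -/
def IsFace {n : ℕ} (X G : Set (Vec n)) : Prop := Convex ℝ G ∧ IsExtreme ℝ X G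

/-- `x` is an extreme point of `C`: it is not the midpoint of two distinct points of `C`. -/
def IsExtremePt {n : ℕ} (C : Set (Vec n)) (x : Vec n) : Prop :=
  x ∈ C ∧ ∀ x₁ ∈ C, ∀ x₂ ∈ C, x = midpoint ℝ x₁ x₂ → x₁ = x₂

/-- The objective `L(x) = (1/2)‖y − Φx‖₂² + λ‖D*x‖₁`. -/
def Lfun {n p q : ℕ} (D : Matrix (Fin n) (Fin p) ℝ) (Phi : Matrix (Fin q) (Fin n) ℝ)
    (y : Vec q) (lam : ℝ) (x : Vec n) : ℝ :=
  (1/2 : ℝ) * ((y - Phi *ᵥ x) ⬝ᵥ (y - Phi *ᵥ x)) + lam * l1 (Dstar D x)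

lemma l1_cont {p : ℕ} : Continuous (l1 : Vec p → ℝ) := by
  unfold l1; fun_prop

lemma l1_mid {p : ℕ} (a b : Vec p) : l1 ((1/2:ℝ) • (a + b)) ≤ (l1 a + l1 b) / 2 := by
  unfold l1
  rw [← Finset.sum_add_distrib, Finset.sum_div]
  refine Finset.sum_le_sum fun i _ => ?_
  simp only [Pi.smul_apply, Pi.add_apply, smul_eq_mul, abs_mul]
  have := abs_add_le (a i) (b i)
  rw [abs_of_pos (by norm_num : (0:ℝ) < 1/2)]
  linarith

lemma sq_mid {q : ℕ} (y a b : Vec q) :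
    (y - (1/2:ℝ) • (a + b)) ⬝ᵥ (y - (1/2:ℝ) • (a + b)) =
      ((y - a) ⬝ᵥ (y - a) + (y - b) ⬝ᵥ (y - b)) / 2 - (a - b) ⬝ᵥ (a - b) / 4 := by
  simp only [dotProduct]
  rw [← Finset.sum_add_distrib, Finset.sum_div, Finset.sum_div, ← Finset.sum_sub_distrib]
  refine Finset.sum_congr rfl fun i _ => ?_
  simp only [Pi.smul_apply, Pi.add_apply, Pi.sub_apply, smul_eq_mul]
  ring

lemma dot_nonneg {q : ℕ} (a : Vec q) : 0 ≤ a ⬝ᵥ a :=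
  Finset.sum_nonneg fun i _ => mul_self_nonneg (a i)

lemma l1_nonneg {p : ℕ} (a : Vec p) : 0 ≤ l1 a :=
  Finset.sum_nonneg fun i _ => abs_nonneg (a i)

lemma L_exists {n p q : ℕ} (D : Matrix (Fin n) (Fin p) ℝ) (Phi : Matrix (Fin q) (Fin n) ℝ)
    (y : Vec q) (lam : ℝ) (hlam : 0 < lam) :
    ∃ x, ∀ z, Lfun D Phi y lam x ≤ Lfun D Phi y lam z := by
  let g : Vec q × Vec p → ℝ := fun w =>
    (1/2 : ℝ) * ((y - w.1) ⬝ᵥ (y - w.1)) + lam * l1 w.2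
  have hg : Continuous g := by
    have h := l1_cont (p := p)
    simp only [g, dotProduct]
    fun_prop
  let T : Vec n →ₗ[ℝ] Vec q × Vec p := (Matrix.mulVecLin Phi).prod (Matrix.mulVecLin Dᵀ)
  have hL : ∀ x, Lfun D Phi y lam x = g (T x) := fun x => rfl
  let c := g 0
  have hcl : IsClosed ((LinearMap.range T : Set (Vec q × Vec p)) ∩ {w | g w ≤ c}) :=
    (Submodule.closed_of_finiteDimensional _).inter (isClosed_le hg continuous_const)
  have hc0 : 0 ≤ c := by
    have h1 := dot_nonneg (y - (0 : Vec q × Vec p).1)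
    have h2 := mul_nonneg hlam.le (l1_nonneg (0 : Vec q × Vec p).2)
    simp only [c, g]; linarith
  have hbd : Bornology.IsBounded ((LinearMap.range T : Set (Vec q × Vec p)) ∩ {w | g w ≤ c}) := by
    refine (Metric.isBounded_closedBall (x := (0 : Vec q × Vec p))
      (r := (‖y‖ + 2 * c + 1) + c / lam)).subset ?_
    rintro ⟨u, v⟩ ⟨-, hw⟩
    have hw : (1/2 : ℝ) * ((y - u) ⬝ᵥ (y - u)) + lam * l1 v ≤ c := hw
    have h1 := dot_nonneg (y - u)
    have h2 := mul_nonneg hlam.le (l1_nonneg v)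
    have hcl : 0 ≤ c / lam := by positivity
    have hny := norm_nonneg y
    have hR : 0 ≤ (‖y‖ + 2 * c + 1) + c / lam := by positivity
    rw [mem_closedBall_zero_iff, Prod.norm_def, max_le_iff, pi_norm_le_iff_of_nonneg hR,
      pi_norm_le_iff_of_nonneg hR]
    constructor
    · intro i
      have h3 : (y i - u i) * (y i - u i) ≤ (y - u) ⬝ᵥ (y - u) :=
        Finset.single_le_sum (f := fun i => (y - u) i * (y - u) i)
          (fun i _ => mul_self_nonneg _) (Finset.mem_univ i)
      have h4 : |y i - u i| ≤ 2 * c + 1 := by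
        have : |y i - u i| * |y i - u i| ≤ 2 * c := by
          rw [abs_mul_abs_self]; linarith
        nlinarith [abs_nonneg (y i - u i), sq_nonneg (|y i - u i| - 1)]
      have h5 : |y i| ≤ ‖y‖ := norm_le_pi_norm y i
      have h6 : |u i| ≤ |y i| + |y i - u i| := by
        have := abs_sub_abs_le_abs_sub (u i) (y i)
        rw [abs_sub_comm] at this
        linarith
      show |u i| ≤ _
      linarith
    · intro i
      have h3 : |v i| ≤ l1 v :=
        Finset.single_le_sum (f := fun i => |v i|)
          (fun i _ => abs_nonneg _) (Finset.mem_univ i)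
      have h4 : l1 v ≤ c / lam := by
        rw [le_div_iff₀ hlam]; linarith
      show |v i| ≤ _
      linarith
  have hK := Metric.isCompact_of_isClosed_isBounded hcl hbd
  obtain ⟨w, ⟨⟨x, rfl⟩, hw⟩, hmin⟩ := hK.exists_isMinOn
    ⟨0, Submodule.zero_mem _, le_refl c⟩ hg.continuousOn
  refine ⟨x, fun z => ?_⟩
  rw [hL, hL]
  by_cases hz : g (T z) ≤ c
  · exact hmin ⟨⟨z, rfl⟩, hz⟩
  · exact le_trans hw (not_le.mp hz).le

/-- the solution set `X = argmin L` is nonempty, and for every `x ∈ X`, with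
`r = ‖D*x‖₁` and `A = x + Ker Φ`, one has `X = A ∩ B_r`, `A ∩ B_r ⊆ ∂B_r`, and
`dir(A) = Ker Φ`. -/
theorem stmt_16 {n p q : ℕ} (hn : 0 < n) (hp : 0 < p) (hq : 0 < q)
    (D : Matrix (Fin n) (Fin p) ℝ) (Phi : Matrix (Fin q) (Fin n) ℝ)
    (y : Vec q) (lam : ℝ) (hlam : 0 < lam)
    (X : Set (Vec n)) (hX : X = {x : Vec n | ∀ z, Lfun D Phi y lam x ≤ Lfun D Phi y lam z}) :
    X.Nonempty ∧
    ∀ x ∈ X,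
      X = ((x + ·) '' {k : Vec n | Phi *ᵥ k = 0}) ∩ Ball D (l1 (Dstar D x)) ∧
      ((x + ·) '' {k : Vec n | Phi *ᵥ k = 0}) ∩ Ball D (l1 (Dstar D x)) ⊆
        Sph D (l1 (Dstar D x)) ∧
      dir ((x + ·) '' {k : Vec n | Phi *ᵥ k = 0}) = {k : Vec n | Phi *ᵥ k = 0} := by
  subst hX
  refine ⟨L_exists D Phi y lam hlam, fun x hx => ?_⟩
  have hx : ∀ z, Lfun D Phi y lam x ≤ Lfun D Phi y lam z := hx
  refine ⟨?_, ?_, ?_⟩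
  · ext z
    constructor
    · intro hz
      have hz : ∀ w, Lfun D Phi y lam z ≤ Lfun D Phi y lam w := hz
      have hm := hx ((1/2:ℝ) • (x + z))
      have hxz := hx z
      have hzx := hz x
      simp only [Lfun, Dstar, Matrix.mulVec_smul, Matrix.mulVec_add, sq_mid] at hm hxz hzx
      have hl := mul_le_mul_of_nonneg_left (l1_mid (Dᵀ *ᵥ x) (Dᵀ *ᵥ z)) hlam.le
      have h0 := dot_nonneg (Phi *ᵥ x - Phi *ᵥ z)
      have h1 : (Phi *ᵥ x - Phi *ᵥ z) ⬝ᵥ (Phi *ᵥ x - Phi *ᵥ z) = 0 := by linarith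
      have h2 : Phi *ᵥ x = Phi *ᵥ z := sub_eq_zero.mp (dotProduct_self_eq_zero.mp h1)
      refine ⟨⟨z - x, ?_, by simp⟩, ?_⟩
      · show Phi *ᵥ (z - x) = 0
        rw [Matrix.mulVec_sub, h2, sub_self]
      · show l1 (Dᵀ *ᵥ z) ≤ l1 (Dᵀ *ᵥ x)
        rw [h2] at hzx
        exact le_of_mul_le_mul_left (by linarith) hlam
    · rintro ⟨⟨k, hk, rfl⟩, hB⟩ w
      refine le_trans ?_ (hx w)
      have hk : Phi *ᵥ k = 0 := hk
      have hB : l1 (Dstar D (x + k)) ≤ l1 (Dstar D x) := hB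
      show Lfun D Phi y lam (x + k) ≤ _
      have := mul_le_mul_of_nonneg_left hB hlam.le
      simp only [Lfun, Matrix.mulVec_add, hk, add_zero]
      linarith
  · rintro _ ⟨⟨k, hk, rfl⟩, hB⟩
    have hk : Phi *ᵥ k = 0 := hk
    refine le_antisymm hB ?_
    have h := hx (x + k)
    simp only [Lfun, Matrix.mulVec_add, hk, add_zero] at h
    exact le_of_mul_le_mul_left (by linarith) hlam
  · have : ((x + ·) '' {k : Vec n | Phi *ᵥ k = 0}) =
        (AffineSubspace.mk' x (LinearMap.ker (Matrix.mulVecLin Phi)) : Set (Vec n)) := by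
      ext z
      simp only [Set.mem_image, Set.mem_setOf_eq, SetLike.mem_coe, AffineSubspace.mem_mk',
        LinearMap.mem_ker, Matrix.mulVecLin_apply, vsub_eq_sub]
      constructor
      · rintro ⟨k, hk, rfl⟩
        simpa using hk
      · intro h
        exact ⟨z - x, h, by simp⟩
    rw [dir, this, AffineSubspace.affineSpan_coe, AffineSubspace.direction_mk']
    ext k
    simp
end
end

section
/- Let r ≥ 0 and let A be an affine subspace of ℝ^n such that ∅ ≠ A ∩ B_r ⊆ ∂B_r. Then there exist a positive integer q, a linear map Φ : ℝ^n → ℝ^q, y ∈ ℝ^q, and λ > 0 such that Ker Φ = dir(A) and argmin_{x ∈ ℝ^n} (1/2)‖y − Φx‖₂² + λ‖D*x‖₁ = A ∩ B_r. -/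
open Matrix Set

noncomputable section

theorem l1_sublin {n p : ℕ} (D : Matrix (Fin n) (Fin p) ℝ) :
    (∀ c : ℝ, ∀ x, l1 (Dstar D (c • x)) = |c| * l1 (Dstar D x)) ∧
    (∀ x y, l1 (Dstar D (x + y)) ≤ l1 (Dstar D x) + l1 (Dstar D y)) ∧
    (∀ x, 0 ≤ l1 (Dstar D x)) := by
  refine ⟨fun c x => ?_, fun x y => ?_, fun x => ?_⟩
  · simp [l1, Dstar, Matrix.mulVec_smul, abs_mul, Finset.mul_sum]
  · simp only [l1, Dstar, Matrix.mulVec_add, Pi.add_apply, ← Finset.sum_add_distrib]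
    exact Finset.sum_le_sum fun i _ => abs_add_le _ _
  · exact Finset.sum_nonneg fun i _ => abs_nonneg _

theorem exists_sub {n : ℕ} (f : Vec n → ℝ) (hs : ∀ c : ℝ, ∀ x, f (c • x) = |c| * f x)
    (ha : ∀ x y, f (x + y) ≤ f x + f y) (h0 : ∀ x, 0 ≤ f x) (V : Submodule ℝ (Vec n))
    (x0 : Vec n) (h : ∀ v ∈ V, f x0 ≤ f (x0 + v)) :
    ∃ g : Vec n →ₗ[ℝ] ℝ, g x0 = f x0 ∧ (∀ v ∈ V, g v = 0) ∧ ∀ x, g x ≤ f x := by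
  by_cases hx : x0 ∈ V
  · refine ⟨0, ?_, by simp, by simpa using h0⟩
    have h1 := h (-x0) (V.neg_mem hx)
    have h2 := hs 0 0
    have h3 := h0 x0
    simp at h1 h2 ⊢
    linarith
  · obtain ⟨ψ, h1, h2⟩ := Submodule.exists_le_ker_of_notMem hx
    let φ : Vec n →ₗ[ℝ] ℝ := (f x0 / ψ x0) • ψ
    have hφ0 : φ x0 = f x0 := by simp [φ, h1]
    have hφV : ∀ v ∈ V, φ v = 0 := fun v hv => by
      have : ψ v = 0 := h2 hv
      simp [φ, this]
    let F : Vec n →ₗ.[ℝ] ℝ := ⟨V ⊔ Submodule.span ℝ {x0}, φ.domRestrict _⟩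
    have hF : ∀ x : F.domain, F x = φ x := fun x => rfl
    obtain ⟨g, hg1, hg2⟩ := exists_extension_of_le_sublinear F f
      (fun c hc x => by rw [hs, abs_of_pos hc]) ha (by
        rintro ⟨x, hx⟩
        rw [hF]
        obtain ⟨v, hv, w, hw, rfl⟩ := Submodule.mem_sup.1 hx
        obtain ⟨t, rfl⟩ := Submodule.mem_span_singleton.1 hw
        simp only [map_add, hφV v hv, map_smul, hφ0, smul_eq_mul, zero_add]
        rcases le_or_gt t 0 with ht | ht
        · exact (mul_nonpos_of_nonpos_of_nonneg ht (h0 _)).trans (h0 _)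
        · have h3 := h (t⁻¹ • v) (V.smul_mem _ hv)
          have h4 : v + t • x0 = t • (x0 + t⁻¹ • v) := by
            rw [smul_add, smul_inv_smul₀ ht.ne', add_comm]
          rw [h4, hs, abs_of_pos ht]
          exact mul_le_mul_of_nonneg_left h3 ht.le)
    refine ⟨g, ?_, fun v hv => ?_, hg2⟩
    · rw [← hφ0]
      exact hg1 ⟨x0, Submodule.mem_sup_right (Submodule.mem_span_singleton_self x0)⟩
    · rw [← hφV v hv]
      exact hg1 ⟨v, Submodule.mem_sup_left hv⟩

theorem exists_Phi {n : ℕ} (V : Submodule ℝ (Vec n)) (g : Vec n →ₗ[ℝ] ℝ)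
    (hg : ∀ v ∈ V, g v = 0) :
    ∃ (Phi : Matrix (Fin n) (Fin n) ℝ) (c : Vec n), (∀ x, Phi *ᵥ x = 0 ↔ x ∈ V) ∧
      ∀ x, c ⬝ᵥ (Phi *ᵥ x) = g x := by
  obtain ⟨W, hW⟩ := V.exists_isCompl
  let P : Vec n →ₗ[ℝ] Vec n := W.subtype ∘ₗ W.projectionOnto V hW.symm
  have hP : ∀ x, P x = 0 ↔ x ∈ V := fun x => by
    simp [P]
  have hPP : ∀ x, P (P x) = P x := fun x => by
    simp [P]
  refine ⟨LinearMap.toMatrix' P, fun i => g (Pi.single i 1), fun x => ?_, fun x => ?_⟩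
  · rw [LinearMap.toMatrix'_mulVec, hP]
  · rw [LinearMap.toMatrix'_mulVec]
    have h1 : g (x - P x) = 0 := hg _ ((hP _).1 (by rw [map_sub, hPP, sub_self]))
    rw [map_sub, sub_eq_zero] at h1
    rw [h1, LinearMap.pi_apply_eq_sum_univ g (P x)]
    simp only [dotProduct, smul_eq_mul]
    refine Finset.sum_congr rfl fun i _ => ?_
    rw [mul_comm]
    congr 2
    ext j
    simp [Pi.single_apply, eq_comm]

/-- for any `r ≥ 0` and affine subspace `A` with `∅ ≠ A ∩ B_r ⊆ ∂B_r`, there exist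
`q`, `Φ : ℝ^n → ℝ^q`, `y ∈ ℝ^q` and `λ > 0` with `Ker Φ = dir(A)` such that the solution set of
`min (1/2)‖y − Φx‖₂² + λ‖D*x‖₁` is exactly `A ∩ B_r`. -/
theorem stmt_19 {n p : ℕ} (hn : 0 < n) (hp : 0 < p) (D : Matrix (Fin n) (Fin p) ℝ)
    (r : ℝ) (hr : 0 ≤ r) (A : AffineSubspace ℝ (Vec n))
    (hne : ((A : Set (Vec n)) ∩ Ball D r).Nonempty)
    (hsub : (A : Set (Vec n)) ∩ Ball D r ⊆ Sph D r) :
    ∃ (q : ℕ) (Phi : Matrix (Fin q) (Fin n) ℝ) (y : Vec q) (lam : ℝ),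
      0 < q ∧ 0 < lam ∧
      {x : Vec n | Phi *ᵥ x = 0} = (A.direction : Set (Vec n)) ∧
      {x : Vec n | ∀ z, Lfun D Phi y lam x ≤ Lfun D Phi y lam z} =
        (A : Set (Vec n)) ∩ Ball D r := by
  obtain ⟨x0, hxA, hxB⟩ := hne
  have hx0 : l1 (Dstar D x0) = r := hsub ⟨hxA, hxB⟩
  obtain ⟨hs, ha, h0⟩ := l1_sublin D
  obtain ⟨g, hg0, hgV, hgf⟩ := exists_sub (fun x => l1 (Dstar D x)) hs ha h0 A.direction x0 (by
    intro v hv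
    by_contra hlt
    simp only [not_le, hx0] at hlt
    have hm : x0 + v ∈ A := by
      rw [add_comm]; exact AffineSubspace.vadd_mem_of_mem_direction hv hxA
    have h1 : l1 (Dstar D (x0 + v)) = r := hsub ⟨hm, hlt.le⟩
    exact hlt.ne h1)
  obtain ⟨Phi, c, hPhi, hc⟩ := exists_Phi A.direction g hgV
  simp only [hx0] at hg0
  have key : ∀ z, Lfun D Phi (Phi *ᵥ x0 + c) 1 z = 1/2 * (c ⬝ᵥ c) + r +
      1/2 * ((Phi *ᵥ (z - x0)) ⬝ᵥ (Phi *ᵥ (z - x0))) + (l1 (Dstar D z) - g z) := by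
    intro z
    have h1 : Phi *ᵥ x0 + c - Phi *ᵥ z = c - Phi *ᵥ (z - x0) := by
      rw [Matrix.mulVec_sub]; abel
    have h2 := hc (z - x0)
    rw [map_sub, hg0] at h2
    rw [Lfun, h1, sub_dotProduct, dotProduct_sub, dotProduct_sub,
      dotProduct_comm (Phi *ᵥ (z - x0)) c, h2]
    ring
  have hsq : ∀ w : Vec n, 0 ≤ w ⬝ᵥ w := fun w =>
    Finset.sum_nonneg fun i _ => mul_self_nonneg _
  have hA : ∀ z, Phi *ᵥ (z - x0) = 0 ↔ z ∈ A := fun z => by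
    rw [hPhi]
    exact AffineSubspace.vsub_right_mem_direction_iff_mem hxA z
  refine ⟨n, Phi, Phi *ᵥ x0 + c, 1, hn, one_pos, Set.ext fun x => hPhi x, Set.ext fun x => ?_⟩
  simp only [Set.mem_setOf_eq, Set.mem_inter_iff, SetLike.mem_coe, Ball]
  constructor
  · intro h
    have h1 := h x0
    rw [key, key, sub_self, Matrix.mulVec_zero, hx0, hg0] at h1
    simp only [dotProduct_zero] at h1
    have h2 := hsq (Phi *ᵥ (x - x0))
    have h3 : g x ≤ l1 (Dstar D x) := hgf x
    have h4 : Phi *ᵥ (x - x0) = 0 := dotProduct_self_eq_zero.1 (by linarith)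
    have h5 := hc (x - x0)
    rw [h4, dotProduct_zero, map_sub, hg0] at h5
    exact ⟨(hA x).1 h4, by linarith⟩
  · rintro ⟨h1, h2⟩ z
    have h4 := (hA x).2 h1
    have h5 := hc (x - x0)
    rw [h4, dotProduct_zero, map_sub, hg0] at h5
    rw [key, key, h4, dotProduct_zero]
    have h3 : g z ≤ l1 (Dstar D z) := hgf z
    have h6 := hsq (Phi *ᵥ (z - x0))
    linarith
end
end
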